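/- arXiv:1412.4840 — 2 statements merged into one kernel-verified Lean document; each statement's English description precedes it below -/
import Mathlib

section
/- For every n ≥ 2 there exist a dynamic (U,V) for the n×n identity matrix I_n and real constants C ≥ c > 0 such that infinitely many natural numbers T satisfy c·T^((n−1)/n) ≤ gap(nT) ≤ C·T^((n−1)/n). -/
/-- A dynamic for the `n × n` identity matrix `Iₙ`: sequences `U V : ℕ → Fin n → ℕ`
starting at the zero vectors such that at each step `t` there are indices `i`, `j`
with `V i t` maximal in `V t` and `U j t` minimal in `U t`, and `U` is incremented
by `e_i` while `V` is incremented by `e_j`. -/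
def IsDynamic (n : ℕ) (U V : ℕ → Fin n → ℕ) : Prop :=
  (∀ l, U 0 l = 0) ∧ (∀ l, V 0 l = 0) ∧
  ∀ t, ∃ i j : Fin n,
    (∀ l, V t l ≤ V t i) ∧ (∀ l, U t j ≤ U t l) ∧
    (∀ l, U (t + 1) l = U t l + if l = i then 1 else 0) ∧
    (∀ l, V (t + 1) l = V t l + if l = j then 1 else 0)

/-- The duality gap of a dynamic at step `t`: `max_l V l t − min_l U l t`. -/
noncomputable def gap (n : ℕ) (U V : ℕ → Fin n → ℕ) (t : ℕ) : ℤ :=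
  ((⨆ l, V t l : ℕ) : ℤ) - ((⨅ l, U t l : ℕ) : ℤ)

section Play

open Relation Finset

variable {ι : Type} [DecidableEq ι]

/-- One round of play in which both players are restricted to the coordinates in `A`. -/
def PlayStep (A : Finset ι) (s s' : (ι → ℕ) × (ι → ℕ)) : Prop :=
  ∃ i ∈ A, ∃ j ∈ A, (∀ l ∈ A, s.2 l ≤ s.2 i) ∧ (∀ l ∈ A, s.1 j ≤ s.1 l) ∧
    s' = (s.1 + Pi.single i 1, s.2 + Pi.single j 1)

/-- The state `s'` can be reached from `s` by finitely many rounds on `A`. -/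
abbrev PlayReach (A : Finset ι) : (ι → ℕ) × (ι → ℕ) → (ι → ℕ) × (ι → ℕ) → Prop :=
  ReflTransGen (PlayStep A)

variable {A : Finset ι} {s s' : (ι → ℕ) × (ι → ℕ)}

lemma PlayReach.eq_of_notMem (h : PlayReach A s s') {l : ι} (hl : l ∉ A) :
    s'.1 l = s.1 l ∧ s'.2 l = s.2 l := by
  induction h with
  | refl => exact ⟨rfl, rfl⟩
  | tail _ h ih =>
    obtain ⟨i, hi, j, hj, -, -, rfl⟩ := h
    have h1 : l ≠ i := fun h => hl (h ▸ hi)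
    have h2 : l ≠ j := fun h => hl (h ▸ hj)
    simpa [Pi.single_apply, h1, h2] using ih

lemma PlayReach.mono (h : PlayReach A s s') : s.1 ≤ s'.1 ∧ s.2 ≤ s'.2 := by
  induction h with
  | refl => exact ⟨le_rfl, le_rfl⟩
  | tail _ h ih =>
    obtain ⟨i, hi, j, hj, -, -, rfl⟩ := h
    exact ⟨fun l => (ih.1 l).trans (by simp), fun l => (ih.2 l).trans (by simp)⟩

lemma PlayReach.sum_add_sum (h : PlayReach A s s') :
    ∑ l ∈ A, s'.1 l + ∑ l ∈ A, s.2 l = ∑ l ∈ A, s.1 l + ∑ l ∈ A, s'.2 l := by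
  induction h with
  | refl => rfl
  | tail _ h ih =>
    obtain ⟨i, hi, j, hj, -, -, rfl⟩ := h
    simp only [Pi.add_apply, sum_add_distrib, hi, hj, if_true,
      Pi.single_apply, Finset.sum_ite_eq']
    omega

/-- Play on `A \ {p}` is play on `A` as long as `p` is neither a strict maximum of `V` nor a
strict minimum of `U`. -/
lemma PlayReach.of_erase {p : ι} (h : PlayReach (A.erase p) s s')
    (hV : ∃ l ∈ A.erase p, s.2 p ≤ s.2 l) (hU : ∃ l ∈ A.erase p, s'.1 l ≤ s.1 p) :
    PlayReach A s s' := by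
  induction h using ReflTransGen.head_induction_on with
  | refl => exact .refl
  | @head a b hab hbs ih =>
    have hp := (PlayReach.eq_of_notMem (ReflTransGen.single hab) (notMem_erase p A))
    have hm := PlayReach.mono (ReflTransGen.single hab)
    have hm' := PlayReach.mono (ReflTransGen.head hab hbs)
    obtain ⟨v, hv, hv'⟩ := hV
    obtain ⟨u, hu, hu'⟩ := hU
    refine .head ?_ (ih ⟨v, hv, ?_⟩ ⟨u, hu, ?_⟩)
    · obtain ⟨i, hi, j, hj, hmax, hmin, rfl⟩ := hab
      refine ⟨i, mem_of_mem_erase hi, j, mem_of_mem_erase hj, fun l hl => ?_, fun l hl => ?_, rfl⟩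
      · by_cases hlp : l = p
        · subst hlp; exact hv'.trans (hmax v hv)
        · exact hmax l (mem_erase.2 ⟨hlp, hl⟩)
      · by_cases hlp : l = p
        · subst hlp; exact (hmin u hu).trans ((hm'.1 u).trans hu')
        · exact hmin l (mem_erase.2 ⟨hlp, hl⟩)
    · rw [hp.2]; exact hv'.trans (hm.2 v)
    · rw [hp.1]; exact hu'

lemma playReach_single_single {p q : ι} (hp : p ∈ A) (hq : q ∈ A) (hpq : p ≠ q)
    (hV : ∀ l ∈ A, s.2 l ≤ s.2 p) (hU : ∀ l ∈ A, s.1 q ≤ s.1 l) (d : ℕ)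
    (hd : s.2 q + d ≤ s.2 p + 1) :
    PlayReach A s (s.1 + Pi.single p d, s.2 + Pi.single q d) := by
  induction d with
  | zero => simpa using ReflTransGen.refl
  | succ d ih =>
    refine (ih (by omega)).tail ⟨p, hp, q, hq, fun l hl => ?_, fun l hl => ?_, ?_⟩
    · have := hV l hl
      by_cases hlq : l = q
      · subst hlq; simp [hpq]; omega
      · simp [hpq, hlq]; omega
    · have := hU l hl
      simp [Pi.single_apply, hpq.symm]; omega
    · simp [add_assoc, ← Pi.single_add]

lemma playReach_single_self {r : ι} (hr : r ∈ A)
    (hV : ∀ l ∈ A, s.2 l ≤ s.2 r) (d : ℕ) (hU : ∀ l ∈ A, l ≠ r → s.1 r + d ≤ s.1 l) :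
    PlayReach A s (s.1 + Pi.single r d, s.2 + Pi.single r d) := by
  induction d with
  | zero => simpa using ReflTransGen.refl
  | succ d ih =>
    refine (ih fun l hl h => by have := hU l hl h; omega).tail
      ⟨r, hr, r, hr, fun l hl => ?_, fun l hl => ?_, ?_⟩
    · have := hV l hl
      by_cases hlr : l = r
      · subst hlr; simp
      · simp [hlr]; omega
    · by_cases hlr : l = r
      · subst hlr; simp
      · have := hU l hl hlr
        simp [hlr]; omega
    · simp [add_assoc, ← Pi.single_add]

/-- Raise `V` on `D` to its maximum `V q = M`, one coordinate after the other; every coordinate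
that has been raised receives `e` rounds of the `U`-player, except for the last one. -/
lemma exists_playReach_fill {q : ι} {T M e : ℕ} (hq : q ∈ A) (hVq : s.2 q = M)
    (hU : ∀ l ∈ A, l ≠ q → s.1 l = T) (hUq : T ≤ s.1 q)
    (hV : ∀ l ∈ A, l ≠ q → s.2 l + e ≤ M) (D : Finset ι) (hD : D ⊆ A.erase q) :
    ∃ s' r, PlayReach A s s' ∧ (r = q ∧ D = ∅ ∧ s' = s ∨ r ∈ D ∧ s'.1 r = T) ∧
      (∀ l ∈ D, l ≠ r → s'.1 l = T + e) ∧ (∀ l ∈ D, s'.2 l = M) ∧ s'.2 q = M ∧ T ≤ s'.1 q ∧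
      (∀ l, l ≠ q → l ∉ D → s'.1 l = s.1 l ∧ s'.2 l = s.2 l) ∧
      ((∀ l ∈ D, s.2 l + e = M) → D.Nonempty → s'.1 q = s.1 q + e) := by
  induction D using Finset.induction_on with
  | empty =>
    exact ⟨s, q, .refl, .inl ⟨rfl, rfl, rfl⟩, by simp, by simp, hVq, hUq, by simp, by simp⟩
  | insert x D hx ih =>
    obtain ⟨s', r, hs', hr, h1, h2, h3, h4, h5, h6⟩ := ih ((subset_insert x D).trans hD)
    have hxA : x ∈ A ∧ x ≠ q := by
      have := hD (mem_insert_self x D); simp at this; exact ⟨this.2, this.1⟩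
    have hDA : ∀ l ∈ D, l ∈ A ∧ l ≠ q := fun l hl => by
      have := hD (mem_insert_of_mem hl); simp at this; exact ⟨this.2, this.1⟩
    have hrA : r ∈ A ∧ s'.2 r = M ∧ r ≠ x := by
      rcases hr with ⟨rfl, -, -⟩ | ⟨hr, -⟩
      · exact ⟨hq, h3, hxA.2.symm⟩
      · exact ⟨(hDA r hr).1, h2 r hr, fun h => hx (h ▸ hr)⟩
    have hx' := h5 x hxA.2 hx
    have hUx : s'.1 x = T := hx'.1.trans (hU x hxA.1 hxA.2)
    have hmax : ∀ l ∈ A, s'.2 l ≤ M := fun l hl => by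
      by_cases hlq : l = q
      · rw [hlq, h3]
      · by_cases hlD : l ∈ D
        · rw [h2 l hlD]
        · rw [(h5 l hlq hlD).2]; have := hV l hl hlq; omega
    have hmin : ∀ l ∈ A, T ≤ s'.1 l := fun l hl => by
      by_cases hlq : l = q
      · rw [hlq]; exact h4
      · by_cases hlD : l ∈ D
        · by_cases hlr : l = r
          · rcases hr with ⟨rfl, -, -⟩ | ⟨-, hr⟩
            · exact absurd hlr hlq
            · rw [hlr, hr]
          · rw [h1 l hlD hlr]; omega
        · rw [(h5 l hlq hlD).1, hU l hl hlq]
    have hVx := hV x hxA.1 hxA.2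
    have hA := playReach_single_single (s := s') hrA.1 hxA.1 hrA.2.2
      (by rw [hrA.2.1]; exact hmax) (by rw [hUx]; exact hmin) e (by omega)
    have hB := playReach_single_single
      (s := (s'.1 + Pi.single r e, s'.2 + Pi.single x e)) (A := A) hq hxA.1 hxA.2.symm
      (fun l hl => by
        have := hmax l hl
        by_cases hlx : l = x
        · subst hlx; simp [hxA.2.symm]; omega
        · simp [hxA.2.symm, hlx]; omega)
      (fun l hl => by
        have := hmin l hl
        simp [Pi.single_apply, hrA.2.2.symm]; omega) (M - (s.2 x + e))
      (by simp [hxA.2.symm]; omega)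
    refine ⟨_, x, (hs'.trans hA).trans hB, .inr ⟨mem_insert_self _ _, ?_⟩, ?_, ?_, ?_, ?_, ?_, ?_⟩
    · simp [hrA.2.2.symm, hxA.2, hUx]
    · intro l hl hlx
      have hl := (mem_insert.1 hl).resolve_left hlx
      have hlq := (hDA l hl).2
      by_cases hlr : l = r
      · rcases hr with ⟨rfl, -, -⟩ | ⟨-, hr⟩
        · exact absurd hlr hlq
        · subst hlr; simp [hlq, hr]
      · simp [hlq, hlr, h1 l hl hlr]
    · intro l hl
      by_cases hlx : l = x
      · subst hlx; simp; omega
      · simp [hlx, h2 l ((mem_insert.1 hl).resolve_left hlx)]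
    · simp [hxA.2.symm, h3]
    · simp [Pi.single_apply]; omega
    · intro l hlq hl
      have hlx : l ≠ x := fun h => hl (h ▸ mem_insert_self _ _)
      have hlD : l ∉ D := fun h => hl (mem_insert_of_mem h)
      have hlr : l ≠ r := by
        rcases hr with ⟨rfl, -, -⟩ | ⟨hr, -⟩
        · exact hlq
        · exact fun h => hlD (h ▸ hr)
      simp [hlx, hlq, hlr, h5 l hlq hlD]
    · intro hex _
      have hxe := hex x (mem_insert_self _ _)
      rcases hr with ⟨rfl, rfl, rfl⟩ | ⟨hr, -⟩
      · simp; omega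
      · have := h6 (fun l hl => hex l (mem_insert_of_mem hl)) ⟨r, hr⟩
        have hrq := (hDA r hr).2.symm
        simp [hrq]; omega

/-- `U` is constantly `T` on `A` and `V` has its strict maximum `M` at `q`. -/
def UFlat (A : Finset ι) (q : ι) (T M : ℕ) (s : (ι → ℕ) × (ι → ℕ)) : Prop :=
  q ∈ A ∧ (∀ l ∈ A, s.1 l = T) ∧ s.2 q = M ∧ ∀ l ∈ A, l ≠ q → s.2 l < M

/-- `V` is constantly `B` on `A` and `U` is `T` at `r` and `T + 1` elsewhere. -/
def PlayStart (A : Finset ι) (r : ι) (T B : ℕ) (s : (ι → ℕ) × (ι → ℕ)) : Prop :=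
  r ∈ A ∧ s.1 r = T ∧ (∀ l ∈ A, l ≠ r → s.1 l = T + 1) ∧ ∀ l ∈ A, s.2 l = B

/-- `V` is constantly `B` on `A` and `U` is `T + S` at `p`, `T` at `r`, and `T + 1` elsewhere. -/
def VFlat (A : Finset ι) (p r : ι) (T B S : ℕ) (s : (ι → ℕ) × (ι → ℕ)) : Prop :=
  p ∈ A ∧ r ∈ A ∧ p ≠ r ∧ s.1 p = T + S ∧ s.1 r = T ∧
    (∀ l ∈ A, l ≠ p → l ≠ r → s.1 l = T + 1) ∧ ∀ l ∈ A, s.2 l = B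

/-- Play on `k` coordinates can increase `min U` by `T` and at the same time the gap by `γ`. -/
def CanRaise (ι : Type) [DecidableEq ι] (k T γ : ℕ) : Prop :=
  ∀ (A : Finset ι) (r : ι) (T₀ B : ℕ) (s : (ι → ℕ) × (ι → ℕ)), #A = k → PlayStart A r T₀ B s →
    ∃ s' q, PlayReach A s s' ∧ UFlat A q (T₀ + T) (B + T + γ) s'

lemma VFlat.sum_fst {p r : ι} {T B S : ℕ} (h : VFlat A p r T B S s) :
    ∑ l ∈ A, s.1 l + 2 = #A * T + S + #A := by
  obtain ⟨hp, hr, hpr, h1, h2, h3, -⟩ := h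
  have hr' : r ∈ A.erase p := mem_erase.2 ⟨hpr.symm, hr⟩
  rw [← add_sum_erase A _ hp, ← add_sum_erase (A.erase p) _ hr', h1, h2,
    sum_congr (g := fun _ => T + 1) rfl
      (fun l hl => h3 l (by simp at hl; tauto) (by simp at hl; tauto) (by simp at hl; tauto))]
  obtain ⟨k, hk⟩ : ∃ k, #A = k + 2 := ⟨#((A.erase p).erase r), by
    have := card_erase_add_one hp; have := card_erase_add_one hr'; omega⟩
  have : #((A.erase p).erase r) = k := by
    have := card_erase_add_one hp; have := card_erase_add_one hr'; omega
  rw [sum_const, this, hk, smul_eq_mul]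
  ring

lemma VFlat.sum_snd {p r : ι} {T B S : ℕ} (h : VFlat A p r T B S s) :
    ∑ l ∈ A, s.2 l = #A * B := by
  rw [sum_congr rfl h.2.2.2.2.2.2, sum_const, smul_eq_mul]

lemma PlayStart.sum_fst {r : ι} {T B : ℕ} (h : PlayStart A r T B s) :
    ∑ l ∈ A, s.1 l + 1 = #A * T + #A := by
  obtain ⟨hr, h1, h2, -⟩ := h
  rw [← add_sum_erase A _ hr, h1,
    sum_congr (g := fun _ => T + 1) rfl
      (fun l hl => h2 l (mem_of_mem_erase hl) (ne_of_mem_erase hl))]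
  have := card_erase_add_one hr
  rw [sum_const, smul_eq_mul, ← this]
  ring

lemma PlayStart.sum_snd {r : ι} {T B : ℕ} (h : PlayStart A r T B s) :
    ∑ l ∈ A, s.2 l = #A * B := by
  rw [sum_congr rfl h.2.2.2, sum_const, smul_eq_mul]

lemma UFlat.exists_vFlat {q : ι} {T M : ℕ} (h : UFlat A q T M s) (hA : 2 ≤ #A) :
    ∃ s' r S, PlayReach A s s' ∧ VFlat A q r T M S s' := by
  obtain ⟨hq, h1, h2, h3⟩ := h
  obtain ⟨s', r, hs, hr, g1, g2, g3, g4, -, -⟩ := exists_playReach_fill (e := 1) hq h2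
    (fun l hl _ => h1 l hl) (h1 q hq).ge h3 (A.erase q) subset_rfl
  have hne : A.erase q ≠ ∅ := by
    have := card_erase_add_one hq
    rintro h; rw [h] at this; simp at this; omega
  obtain ⟨hr, hr'⟩ := hr.resolve_left (fun h => hne h.2.1)
  rw [mem_erase] at hr
  refine ⟨s', r, s'.1 q - T, hs, hq, hr.2, hr.1.symm, by omega, hr',
    fun l hl hlq hlr => g1 l (mem_erase.2 ⟨hlq, hl⟩) hlr, fun l hl => ?_⟩
  by_cases hlq : l = q
  · rw [hlq, g3]
  · exact g2 l (mem_erase.2 ⟨hlq, hl⟩)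

/-- If all deficits are exactly one, filling up leads to a start position. -/
lemma UFlat.exists_playStart {q : ι} {T M : ℕ} (h : UFlat A q T (M + 1) s) (hA : 2 ≤ #A)
    (hV : ∀ l ∈ A, l ≠ q → s.2 l = M) :
    ∃ s' r, PlayReach A s s' ∧ PlayStart A r T (M + 1) s' := by
  obtain ⟨hq, h1, h2, h3⟩ := h
  obtain ⟨s', r, hs, hr, g1, g2, g3, g4, -, g5⟩ := exists_playReach_fill (e := 1) hq h2
    (fun l hl _ => h1 l hl) (h1 q hq).ge h3 (A.erase q) subset_rfl
  have hne : A.erase q ≠ ∅ := by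
    have := card_erase_add_one hq
    rintro h; rw [h] at this; simp at this; omega
  obtain ⟨hr, hr'⟩ := hr.resolve_left (fun h => hne h.2.1)
  have g5 := g5 (fun l hl => by rw [mem_erase] at hl; rw [hV l hl.2 hl.1])
    (nonempty_iff_ne_empty.2 hne)
  rw [mem_erase] at hr
  refine ⟨s', r, hs, hr.2, hr', fun l hl hlr => ?_, fun l hl => ?_⟩
  · by_cases hlq : l = q
    · rw [hlq, g5, h1 q hq]
    · exact g1 l (mem_erase.2 ⟨hlq, hl⟩) hlr
  · by_cases hlq : l = q
    · rw [hlq, g3]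
    · exact g2 l (mem_erase.2 ⟨hlq, hl⟩)

lemma PlayStart.exists_uFlat {r : ι} {T B : ℕ} (h : PlayStart A r T B s) :
    ∃ s', PlayReach A s s' ∧ UFlat A r (T + 1) (B + 1) s' ∧ ∀ l ∈ A, l ≠ r → s'.2 l = B := by
  obtain ⟨hr, h1, h2, h3⟩ := h
  have hV : ∀ l ∈ A, l ≠ r → (s.2 + Pi.single r 1 : ι → ℕ) l = B := fun l hl hlr => by
    simp [hlr, h3 l hl]
  refine ⟨_, playReach_single_self hr (fun l hl => by rw [h3 l hl, h3 r hr]) 1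
    (fun l hl hlr => by rw [h2 l hl hlr, h1]), ⟨hr, fun l hl => ?_, ?_, fun l hl hlr => ?_⟩, hV⟩
  · by_cases hlr : l = r
    · simp [hlr, h1]
    · simp [hlr, h2 l hl]
  · simp [h3 r hr]
  · have := hV l hl hlr; simp only at *; omega

lemma VFlat.exists_uFlat {p r : ι} {T B S γ k : ℕ} (h : VFlat A p r T B S s) (hk : #A = k + 1)
    (hS : 1 ≤ S) (hR : CanRaise ι k S γ) :
    ∃ s' q, PlayReach A s s' ∧ UFlat A q (T + S) (B + S + γ) s' := by
  obtain ⟨hp, hr, hpr, h1, h2, h3, h4⟩ := h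
  have hr' : r ∈ A.erase p := mem_erase.2 ⟨hpr.symm, hr⟩
  obtain ⟨s', q, hs, hq, g1, g2, g3⟩ := hR (A.erase p) r T B s
    (by have := card_erase_add_one hp; omega)
    ⟨hr', h2, fun l hl hlr => h3 l (mem_of_mem_erase hl) (ne_of_mem_erase hl) hlr,
      fun l hl => h4 l (mem_of_mem_erase hl)⟩
  have hp' := hs.eq_of_notMem (notMem_erase p A)
  refine ⟨s', q, hs.of_erase ⟨r, hr', by rw [h4 p hp, h4 r hr]⟩ ⟨q, hq, by rw [g1 q hq, h1]⟩,
    mem_of_mem_erase hq, fun l hl => ?_, g2, fun l hl hlq => ?_⟩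
  · by_cases hlp : l = p
    · rw [hlp, hp'.1, h1]
    · exact g1 l (mem_erase.2 ⟨hlp, hl⟩)
  · by_cases hlp : l = p
    · rw [hlp, hp'.2, h4 p hp]; omega
    · exact g3 l (mem_erase.2 ⟨hlp, hl⟩) hlq

lemma CanRaise.one_zero (k : ℕ) : CanRaise ι k 1 0 := by
  intro A r T₀ B s _ h
  obtain ⟨s', h1, h2, -⟩ := h.exists_uFlat
  exact ⟨s', r, h1, h2⟩

lemma CanRaise.succ {k T γ : ℕ} (hk : 2 ≤ k) (h : CanRaise ι k T γ) : CanRaise ι k (T + 1) γ := by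
  intro A r T₀ B s hA hs
  obtain ⟨s₁, h1, h2, h3⟩ := hs.exists_uFlat
  obtain ⟨s₂, r₂, h4, h5⟩ := h2.exists_playStart (hA ▸ hk) h3
  obtain ⟨s₃, q, h6, h7⟩ := h A r₂ _ _ s₂ hA h5
  refine ⟨s₃, q, (h1.trans h4).trans h6, ?_⟩
  convert h7 using 1 <;> ring

lemma CanRaise.mono {k T T' γ : ℕ} (hk : 2 ≤ k) (h : CanRaise ι k T γ) (hT : T ≤ T') :
    CanRaise ι k T' γ := by
  induction hT with
  | refl => exact h
  | step _ ih => exact ih.succ hk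

lemma UFlat.exists_overshoot {q : ι} {T M d : ℕ} (h : UFlat A q T M s) (hA : 2 ≤ #A)
    (hV : ∀ l ∈ A, l ≠ q → s.2 l + d = M) :
    ∃ s' r, r ≠ q ∧ PlayReach A s s' ∧ UFlat A r (T + d + 1) (M + d + 2) s' ∧ s'.2 q = M := by
  obtain ⟨hq, h1, h2, h3⟩ := h
  obtain ⟨x, hx, hxq⟩ := exists_mem_ne (by omega : 1 < #A) q
  have e1 := playReach_single_single (s := s) hq hx hxq.symm
    (fun l hl => by
      by_cases hlq : l = q
      · rw [hlq]
      · rw [h2]; exact (h3 l hl hlq).le)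
    (fun l hl => by rw [h1 l hl, h1 x hx]) (d + 1) (by have := hV x hx hxq; omega)
  set s₁ : (ι → ℕ) × (ι → ℕ) := (s.1 + Pi.single q (d + 1), s.2 + Pi.single x (d + 1)) with hs₁
  have hUq : s₁.1 q = T + d + 1 := by simp [hs₁, h1 q hq, add_assoc]
  have hU : ∀ l ∈ A, l ≠ q → s₁.1 l = T := fun l hl hlq => by
    simp [hs₁, hlq, h1 l hl]
  have hVx : s₁.2 x = M + 1 := by simp [hs₁]; have := hV x hx hxq; omega
  have hVq : s₁.2 q = M := by simp [hs₁, hxq.symm, h2]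
  have hVl : ∀ l ∈ A, l ≠ q → l ≠ x → s₁.2 l + d = M := fun l hl hlq hlx => by
    simp [hs₁, hlx, hV l hl hlq]
  have hxA : x ∈ A.erase q := mem_erase.2 ⟨hxq, hx⟩
  obtain ⟨s₂, r, e2, hr, g1, g2, g3, g4, g5, g6⟩ := exists_playReach_fill (e := d + 1) (T := T)
    hxA hVx
    (fun l hl hlx => hU l (mem_of_mem_erase hl) (ne_of_mem_erase hl)) (hU x hx hxq).ge
    (fun l hl hlx => by
      have := hVl l (mem_of_mem_erase hl) (ne_of_mem_erase hl) hlx; omega)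
    ((A.erase q).erase x) subset_rfl
  have hq2 := e2.eq_of_notMem (notMem_erase q A)
  have hmem : ∀ l ∈ A, l ≠ q → l ≠ x → l ∈ (A.erase q).erase x := fun l hl hlq hlx =>
    mem_erase.2 ⟨hlx, mem_erase.2 ⟨hlq, hl⟩⟩
  have hr' : r ∈ A.erase q ∧ s₂.1 r = T ∧ (∀ l ∈ A, l ≠ r → s₂.1 l = T + d + 1) := by
    rcases hr with ⟨rfl, hD, rfl⟩ | ⟨hr, hrT⟩
    · refine ⟨hxA, hU _ hx hxq, fun l hl hlr => ?_⟩
      by_cases hlq : l = q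
      · rw [hlq, hUq]
      · have := hmem l hl hlq hlr; simp [hD] at this
    · refine ⟨mem_of_mem_erase hr, hrT, fun l hl hlr => ?_⟩
      by_cases hlq : l = q
      · rw [hlq, hq2.1, hUq]
      · by_cases hlx : l = x
        · rw [hlx, g6 (fun l hl => ?_) ⟨r, hr⟩, hU x hx hxq]; · ring
          simp at hl
          have := hVl l hl.2.2 hl.2.1 hl.1; omega
        · rw [g1 l (hmem l hl hlq hlx) hlr]; ring
  obtain ⟨hrA, hrT, hrl⟩ := hr'
  have hrq := ne_of_mem_erase hrA
  have hrA := mem_of_mem_erase hrA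
  have hV2 : ∀ l ∈ A, l ≠ q → s₂.2 l = M + 1 := fun l hl hlq => by
    by_cases hlx : l = x
    · rw [hlx, g3]
    · exact g2 l (hmem l hl hlq hlx)
  have hVq2 : s₂.2 q = M := by rw [hq2.2, hVq]
  have e3 := playReach_single_self (s := s₂) hrA
    (fun l hl => by
      rw [hV2 r hrA hrq]
      by_cases hlq : l = q
      · rw [hlq, hVq2]; omega
      · rw [hV2 l hl hlq]) (d + 1)
    (fun l hl hlr => by rw [hrl l hl hlr, hrT]; omega)
  refine ⟨_, r, hrq, (e1.trans (e2.of_erase ⟨x, hxA, by omega⟩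
    ⟨r, mem_erase.2 ⟨hrq, hrA⟩, by omega⟩)).trans e3, ⟨hrA, fun l hl => ?_, ?_, fun l hl hlr => ?_⟩,
    ?_⟩
  · by_cases hlr : l = r
    · simp [hlr, hrT, add_assoc]
    · simp [hlr, hrl l hl hlr]
  · simp [hV2 r hrA hrq]; omega
  · by_cases hlq : l = q
    · simp [hlq, hrq.symm, hVq2]; omega
    · simp [hlr, hV2 l hl hlq]
  · simp [hrq.symm, hVq2]

lemma CanRaise.three_one {k : ℕ} (hk : 2 ≤ k) : CanRaise ι k 3 1 := by
  intro A r T₀ B s hA hs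
  obtain ⟨s₁, h1, h2, h3⟩ := hs.exists_uFlat
  obtain ⟨s₂, q, -, h4, h5, -⟩ := h2.exists_overshoot (d := 1) (hA ▸ hk)
    (fun l hl hlr => by rw [h3 l hl hlr])
  exact ⟨s₂, q, h1.trans h4, h5⟩

/-- On two coordinates the overshoot can be iterated. -/
lemma UFlat.exists_overshoot_iterate {q : ι} {T M d : ℕ} (h : UFlat A q T M s) (hA : #A = 2)
    (hV : ∀ l ∈ A, l ≠ q → s.2 l + d = M) (m : ℕ) :
    ∃ s' r, PlayReach A s s' ∧ UFlat A r (T + m * d + m * m) (M + m * d + m * m + m) s' ∧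
      ∀ l ∈ A, l ≠ r → s'.2 l + d + 2 * m = M + m * d + m * m + m := by
  induction m with
  | zero => exact ⟨s, q, .refl, by simpa using h, by simpa using hV⟩
  | succ m ih =>
    obtain ⟨s', r, h1, h2, h3⟩ := ih
    obtain ⟨s₂, x, hxr, h4, h5, h6⟩ := h2.exists_overshoot (d := d + 2 * m) hA.ge
      (fun l hl hlr => by rw [← h3 l hl hlr]; ring)
    refine ⟨s₂, x, h1.trans h4, ?_, fun l hl hlx => ?_⟩
    · convert h5 using 1 <;> ring
    · have hlr : l = r := by
        by_contra hlr
        have : ({l, x, r} : Finset ι) ⊆ A := by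
          intro y; simp; rintro (rfl | rfl | rfl); exacts [hl, h5.1, h2.1]
        have := card_le_card this
        rw [card_insert_of_notMem (by simp [hlx, hlr]), card_insert_of_notMem (by simp [hxr]),
          card_singleton] at this
        omega
      rw [hlr, h6]; ring

lemma CanRaise.two (γ : ℕ) : CanRaise ι 2 (γ * γ + γ + 1) γ := by
  intro A r T₀ B s hA hs
  obtain ⟨s₁, h1, h2, h3⟩ := hs.exists_uFlat
  obtain ⟨s₂, q, h4, h5, -⟩ := h2.exists_overshoot_iterate (d := 1) hA
    (fun l hl hlr => by rw [h3 l hl hlr]) γ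
  refine ⟨s₂, q, h1.trans h4, ?_⟩
  convert h5 using 1 <;> ring

/-- Play on `k + 1` coordinates can be continued by play on `k` of them. -/
lemma CanRaise.add {k T h γ : ℕ} (hk : 1 ≤ k) (hT : CanRaise ι (k + 1) T h)
    (hR : CanRaise ι k (1 + (k + 1) * h) γ) :
    CanRaise ι (k + 1) (T + (1 + (k + 1) * h)) (h + γ) := by
  intro A r T₀ B s hA hs
  obtain ⟨s₁, q₁, h1, h2⟩ := hT A r T₀ B s hA hs
  obtain ⟨s₂, r₂, S, h3, h4⟩ := h2.exists_vFlat (by omega)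
  have e1 := PlayReach.sum_add_sum (h1.trans h3)
  have e2 := h4.sum_fst
  rw [h4.sum_snd, hs.sum_snd] at e1
  have e3 := hs.sum_fst
  rw [hA] at e1 e2 e3
  have hS : S = 1 + (k + 1) * h := by nlinarith
  obtain ⟨s₃, q, h5, h6⟩ := h4.exists_uFlat hA (by omega) (hS ▸ hR)
  refine ⟨s₃, q, (h1.trans h3).trans h5, ?_⟩
  convert h6 using 1 <;> rw [hS] <;> ring

lemma succ_pow_le_add_two_pow_mul {l : ℕ} (hl : 1 ≤ l) (m : ℕ) :
    (l + 1) ^ (m + 1) + l ^ m ≤ l ^ (m + 1) + 2 ^ (m + 1) * l ^ m := by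
  induction m with
  | zero => simp
  | succ m ih =>
    have h1 : l ^ m ≤ l ^ (m + 1) := Nat.pow_le_pow_right hl (by omega)
    obtain ⟨a, ha⟩ : ∃ a, 2 ^ (m + 1) = a + 1 :=
      ⟨2 ^ (m + 1) - 1, by have := Nat.one_le_two_pow (n := m + 1); omega⟩
    have h2 : a * l ^ m ≤ a * l ^ (m + 1) := Nat.mul_le_mul_left _ h1
    rw [pow_succ 2, ha]
    rw [ha] at ih
    have := Nat.mul_le_mul_right (l + 1) ih
    simp only [pow_succ] at *
    nlinarith

/-- If `Q` can be raised according to `R`, then it can be raised through a whole stage from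
`W * l ^ (m + 1)` to `W * (l + 1) ^ (m + 1)` at a cost of order `l ^ (m + 1)`. -/
lemma exists_stage {R Q : ℕ → ℕ → Prop} {m D K c : ℕ} (hm : 1 ≤ m) (hK : 1 ≤ K)
    (hmono : ∀ T T' γ, R T γ → T ≤ T' → R T' γ)
    (hR : ∀ l ≥ 1, ∀ γ ≤ l ^ m, R (D * l ^ (m + 1)) γ)
    (hQ : ∀ T h γ, Q T h → R (c + K * h) γ → Q (T + (c + K * h)) (h + γ))
    {W : ℕ} (hW : W = D * (2 ^ (m + 1)) ^ (m + 1)) (hW1 : 1 ≤ W) {l : ℕ} (hl : 1 ≤ l) {T h : ℕ}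
    (hT : Q T (W * l ^ (m + 1))) (h1 : W * l ^ (m + 1) ≤ h) (h2 : h ≤ W * (l + 1) ^ (m + 1)) :
    ∃ T', Q T' h ∧ T + W * l ^ (m + 1) ≤ T' ∧ T' ≤ T + W * (c + K * W) * (l + 1) ^ (m + 1) := by
  obtain ⟨Δ, hΔ⟩ : ∃ Δ, (l + 1) ^ (m + 1) = l ^ (m + 1) + Δ :=
    ⟨(l + 1) ^ (m + 1) - l ^ (m + 1), by
      have := Nat.pow_le_pow_left (show l ≤ l + 1 by omega) (m + 1); omega⟩
  have hΔ' : Δ ≤ (2 ^ (m + 1) * l) ^ m := by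
    have e1 := succ_pow_le_add_two_pow_mul hl m
    have e2 : 2 ^ (m + 1) ≤ (2 ^ (m + 1)) ^ m := Nat.le_self_pow (by omega) _
    rw [mul_pow]
    have := Nat.mul_le_mul_right (l ^ m) e2
    omega
  have hpow : D * (2 ^ (m + 1) * l) ^ (m + 1) = W * l ^ (m + 1) := by
    rw [hW, mul_pow, mul_assoc]
  set h₀ := W * l ^ (m + 1) with hh₀
  have hstage : ∀ i j, j ≤ i * Δ → h₀ + j ≤ W * (l + 1) ^ (m + 1) →
      ∃ T', Q T' (h₀ + j) ∧ T + i * h₀ ≤ T' ∧ T' ≤ T + i * (c + K * (W * (l + 1) ^ (m + 1))) := by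
    intro i
    induction i with
    | zero =>
      intro j hj _
      obtain rfl : j = 0 := by simpa using hj
      exact ⟨T, hT, by simp, by simp⟩
    | succ i ih =>
      intro j hj hj2
      rw [Nat.succ_mul] at hj
      obtain ⟨T', e1, e2, e3⟩ := ih (j - min j Δ) (by omega) (by omega)
      have hle : h₀ + (j - min j Δ) ≤ W * (l + 1) ^ (m + 1) := by omega
      have hle' := Nat.mul_le_mul_left K hle
      have hge : h₀ ≤ K * (h₀ + (j - min j Δ)) :=
        (Nat.le_add_right _ _).trans (Nat.le_mul_of_pos_left _ hK)
      have := hQ _ _ (min j Δ) e1 (hmono _ _ _ (hR (2 ^ (m + 1) * l)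
        (Nat.mul_pos (by positivity) hl) (min j Δ) ((min_le_right _ _).trans hΔ')) (by omega))
      refine ⟨_, by convert this using 1; omega, ?_, ?_⟩
      · rw [Nat.succ_mul]; omega
      · rw [Nat.succ_mul]; omega
  obtain ⟨T', e1, e2, e3⟩ := hstage W (h - h₀) (by rw [hΔ, mul_add] at h2; omega) (by omega)
  refine ⟨T', by convert e1 using 1; omega, (Nat.add_le_add_left ?_ _).trans e2,
    e3.trans (Nat.add_le_add_left ?_ _)⟩
  · exact Nat.le_mul_of_pos_left _ hW1
  · have : c ≤ c * (l + 1) ^ (m + 1) := Nat.le_mul_of_pos_right _ (by positivity)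
    nlinarith [Nat.mul_le_mul_left W this]

lemma pow_succ_add_pow_le (l m : ℕ) : l ^ (m + 2) + (l + 1) ^ (m + 1) ≤ (l + 1) ^ (m + 2) := by
  have := Nat.mul_le_mul_right l (Nat.pow_le_pow_left (show l ≤ l + 1 by omega) (m + 1))
  rw [pow_succ, pow_succ (l + 1) (m + 1)]
  nlinarith

lemma CanRaise.exists_forall {m : ℕ} (hm : 1 ≤ m) (h : ℕ) : ∃ T, CanRaise ι (m + 2) T h := by
  induction h with
  | zero => exact ⟨1, .one_zero _⟩
  | succ h ih =>
    rcases Nat.eq_zero_or_pos h with rfl | hh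
    · exact ⟨3, .three_one (by omega)⟩
    · obtain ⟨T, hT⟩ := ih
      exact ⟨_, hT.add (by omega) ((CanRaise.three_one (by omega)).mono (by omega) (by nlinarith))⟩

/-- On `m + 1` coordinates, raising the gap by `l ^ m` takes of order `l ^ (m + 1)` rounds. -/
theorem CanRaise.exists_bound (m : ℕ) (hm : 1 ≤ m) :
    ∃ D ≥ 1, ∀ l ≥ 1, ∀ γ ≤ l ^ m, CanRaise ι (m + 1) (D * l ^ (m + 1)) γ := by
  induction m, hm using Nat.le_induction with
  | base =>
    refine ⟨3, by omega, fun l hl γ hγ => (CanRaise.two γ).mono le_rfl ?_⟩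
    simp only [pow_succ, pow_zero, one_mul] at *
    nlinarith
  | succ m hm ih =>
    obtain ⟨D, hD, hR⟩ := ih
    set W := D * (2 ^ (m + 1)) ^ (m + 1) with hW
    have hW1 : 1 ≤ W := Nat.mul_pos hD (by positivity)
    choose f hf using CanRaise.exists_forall (ι := ι) hm
    have key : ∀ l ≥ 1, ∀ h ≤ W * l ^ (m + 1),
        ∃ T ≤ (∑ h ∈ range (W + 1), f h + W * (1 + (m + 2) * W)) * l ^ (m + 2),
          CanRaise ι (m + 2) T h := by
      intro l hl
      induction l, hl using Nat.le_induction with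
      | base =>
        intro h hh
        have : f h ≤ ∑ h ∈ range (W + 1), f h :=
          single_le_sum (f := f) (fun _ _ => Nat.zero_le _) (by simp at *; omega)
        exact ⟨f h, by simp; omega, hf h⟩
      | succ l hl ih =>
        intro h hh
        rcases le_total h (W * l ^ (m + 1)) with h1 | h1
        · obtain ⟨T, hT, hT'⟩ := ih h h1
          exact ⟨T, hT.trans (Nat.mul_le_mul_left _ (Nat.pow_le_pow_left (by omega) _)), hT'⟩
        · obtain ⟨T, hT, hT'⟩ := ih _ le_rfl
          obtain ⟨T', e1, -, e3⟩ := exists_stage (R := CanRaise ι (m + 1)) (Q := CanRaise ι (m + 2))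
            (K := m + 2) (c := 1) hm (by omega) (fun T T' γ h h' => h.mono (by omega) h') hR
            (fun T h γ h1 h2 => h1.add (by omega) h2) hW hW1 hl hT' h1 hh
          refine ⟨T', ?_, e1⟩
          have := Nat.mul_le_mul_left (∑ h ∈ range (W + 1), f h + W * (1 + (m + 2) * W))
            (pow_succ_add_pow_le l m)
          have : 0 ≤ (∑ h ∈ range (W + 1), f h) * (l + 1) ^ (m + 1) := Nat.zero_le _
          nlinarith
    refine ⟨∑ h ∈ range (W + 1), f h + W * (1 + (m + 2) * W) + 1, le_add_self, fun l hl γ hγ => ?_⟩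
    obtain ⟨T, hT, hT'⟩ := key l hl γ (hγ.trans (Nat.le_mul_of_pos_left _ hW1))
    exact hT'.mono (by omega) (hT.trans (Nat.mul_le_mul_right _ (Nat.le_succ _)))

lemma exists_path {α : Type*} {r : α → α → Prop} {φ : α → ℕ} (hφ : ∀ a b, r a b → φ b = φ a + 1)
    {a b : α} (h : ReflTransGen r a b) :
    ∃ p : ℕ → α, p (φ a) = a ∧ p (φ b) = b ∧ φ a ≤ φ b ∧
      ∀ t, φ a ≤ t → t < φ b → r (p t) (p (t + 1)) := by
  induction h with
  | refl => exact ⟨fun _ => a, rfl, rfl, le_rfl, fun t h h' => by omega⟩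
  | @tail b c _ hbc ih =>
    obtain ⟨p, h1, h2, h3, h4⟩ := ih
    have hc := hφ b c hbc
    refine ⟨fun t => if t ≤ φ b then p t else c, by simp [h3, h1], by simp [hc], by omega,
      fun t ht ht' => ?_⟩
    rcases (by omega : t < φ b ∨ t = φ b) with h | rfl
    · simp only [if_pos h.le, if_pos (Nat.succ_le_of_lt h)]
      exact h4 t ht h
    · simp only [if_pos le_rfl, if_neg (Nat.not_succ_le_self _), h2]
      exact hbc

/-- Finite paths through a sequence of points glue to an infinite path through all of them. -/
lemma exists_infinite_path {α : Type*} {r : α → α → Prop} {φ : α → ℕ}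
    (hφ : ∀ a b, r a b → φ b = φ a + 1) (x : ℕ → α) (h0 : φ (x 0) = 0)
    (hx : ∀ l, ReflTransGen r (x l) (x (l + 1))) (hlt : StrictMono fun l => φ (x l)) :
    ∃ f : ℕ → α, (∀ t, r (f t) (f (t + 1))) ∧ ∀ l, f (φ (x l)) = x l := by
  choose p h1 h2 _ h4 using fun l => exists_path hφ (hx l)
  have hL : ∀ t, ∃ l, φ (x l) ≤ t ∧ t < φ (x (l + 1)) := by
    intro t
    induction t with
    | zero => exact ⟨0, h0.le, by have := hlt Nat.zero_lt_one; simp only [h0] at this; exact this⟩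
    | succ t ih =>
      obtain ⟨l, e1, e2⟩ := ih
      by_cases h : t + 1 < φ (x (l + 1))
      · exact ⟨l, by omega, h⟩
      · exact ⟨l + 1, by omega, by
          have := hlt (show l + 1 < l + 1 + 1 by omega); simp only at *; omega⟩
  choose L e1 e2 using hL
  have huniq : ∀ t l, φ (x l) ≤ t → t < φ (x (l + 1)) → L t = l := by
    intro t l e3 e4
    have a1 := hlt.lt_iff_lt.1 ((e1 t).trans_lt e4)
    have a2 := hlt.lt_iff_lt.1 (e3.trans_lt (e2 t))
    omega
  have hxl : ∀ l, p (L (φ (x l))) (φ (x l)) = x l := fun l => by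
    rw [huniq _ l le_rfl (hlt (Nat.lt_succ_self l)), h1]
  refine ⟨fun t => p (L t) t, fun t => ?_, hxl⟩
  have hr := h4 (L t) t (e1 t) (e2 t)
  rcases (by have := e2 t; omega : t + 1 < φ (x (L t + 1)) ∨ t + 1 = φ (x (L t + 1))) with h | h
  · have := huniq (t + 1) (L t) (by have := e1 t; omega) h
    simp only [this]
    exact hr
  · rw [h, h2] at hr
    simp only
    rw [h, hxl]
    exact hr

lemma exists_seq {α : Type*} {P : ℕ → α → Prop} {R : ℕ → α → α → Prop} {a : α} (ha : P 0 a)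
    (h : ∀ l a, P l a → ∃ b, P (l + 1) b ∧ R l a b) :
    ∃ f : ℕ → α, f 0 = a ∧ ∀ l, P l (f l) ∧ R l (f l) (f (l + 1)) := by
  choose! g hg using h
  have hP : ∀ l, P l (Nat.rec a g l) := fun l => by
    induction l with
    | zero => exact ha
    | succ l ih => exact (hg l _ ih).1
  exact ⟨fun l => Nat.rec a g l, rfl, fun l => ⟨hP l, (hg l _ (hP l)).2⟩⟩

lemma gap_eq {n : ℕ} {U V : ℕ → Fin n → ℕ} {t : ℕ} {q r : Fin n} (hV : ∀ l, V t l ≤ V t q)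
    (hU : ∀ l, U t r ≤ U t l) : gap n U V t = (V t q : ℤ) - U t r := by
  have : Nonempty (Fin n) := ⟨q⟩
  have h1 : ⨆ l, V t l = V t q := le_antisymm (ciSup_le hV)
    (le_ciSup (Set.finite_range _).bddAbove q)
  have h2 : ⨅ l, U t l = U t r := le_antisymm (ciInf_le (OrderBot.bddBelow _) r) (le_ciInf hU)
  rw [gap, h1, h2]

/-- A sequence of states, reachable one after the other, on which the gap is of the right order
yields a dynamic as desired. -/
lemma exists_dynamic_of_states {m : ℕ} (x : ℕ → (Fin (m + 1) → ℕ) × (Fin (m + 1) → ℕ))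
    (τ g : ℕ → ℕ) {a E w₁ w₂ : ℕ} (hE : 1 ≤ E) (hw : 1 ≤ w₁)
    (h0 : PlayReach univ 0 (x 0)) (hx : ∀ l, PlayReach univ (x l) (x (l + 1)))
    (hτ : StrictMono τ) (hsum : ∀ l, ∑ i, (x l).1 i = (m + 1) * τ l)
    (hg : ∀ l, ∃ q r, (∀ i, (x l).2 i ≤ (x l).2 q) ∧ (∀ i, (x l).1 r ≤ (x l).1 i) ∧
      (x l).2 q = (x l).1 r + g l)
    (h1 : ∀ l, (l + 1) ^ (m + 1) ≤ a * τ l) (h2 : ∀ l, τ l ≤ E * (l + 1) ^ (m + 1))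
    (h3 : ∀ l, w₁ * (l + 1) ^ m ≤ g l) (h4 : ∀ l, g l ≤ w₂ * (l + 1) ^ m) :
    ∃ U V : ℕ → Fin (m + 1) → ℕ, IsDynamic (m + 1) U V ∧
      ∃ c C : ℝ, 0 < c ∧ c ≤ C ∧
        {T : ℕ |
          c * (T : ℝ) ^ ((((m + 1 : ℕ) : ℝ) - 1) / (m + 1 : ℕ)) ≤ (gap (m + 1) U V ((m + 1) * T) : ℝ) ∧
          (gap (m + 1) U V ((m + 1) * T) : ℝ) ≤
            C * (T : ℝ) ^ ((((m + 1 : ℕ) : ℝ) - 1) / (m + 1 : ℕ))}.Infinite := by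
  have ha : 1 ≤ a := by
    have := h1 0
    rcases Nat.eq_zero_or_pos a with rfl | h
    · simp at this
    · exact h
  have hτ0 : 0 < τ 0 := by
    have := h1 0
    rcases Nat.eq_zero_or_pos (τ 0) with h | h
    · simp [h] at this
    · exact h
  have hφ : ∀ s s' : (Fin (m + 1) → ℕ) × (Fin (m + 1) → ℕ), PlayStep univ s s' →
      ∑ i, s'.1 i = ∑ i, s.1 i + 1 := by
    rintro s _ ⟨i, -, j, -, -, -, rfl⟩
    simp [sum_add_distrib]
  obtain ⟨f, hf, hfx⟩ := exists_infinite_path hφ (fun l => Nat.casesOn l 0 x) (by simp)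
    (fun l => by cases l with
      | zero => exact h0
      | succ l => exact hx l)
    (strictMono_nat_of_lt_succ fun l => by
      cases l with
      | zero => simpa [hsum] using hτ0
      | succ l => simpa [hsum] using hτ (Nat.lt_succ_self l))
  have hf0 : f 0 = 0 := by simpa using hfx 0
  have hfl : ∀ l, f ((m + 1) * τ l) = x l := fun l => by simpa [hsum] using hfx (l + 1)
  refine ⟨fun t => (f t).1, fun t => (f t).2, ⟨by simp [hf0], by simp [hf0], fun t => ?_⟩, ?_⟩
  · obtain ⟨i, -, j, -, hi, hj, h⟩ := hf t
    refine ⟨i, j, by simpa using hi, by simpa using hj, fun l => ?_, fun l => ?_⟩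
    · simp [h, Pi.single_apply]
    · simp [h, Pi.single_apply]
  have hgap : ∀ l, gap (m + 1) (fun t => (f t).1) (fun t => (f t).2) ((m + 1) * τ l) = g l := by
    intro l
    obtain ⟨q, r, e1, e2, e3⟩ := hg l
    rw [gap_eq (q := q) (r := r) (by simpa [hfl] using e1) (by simpa [hfl] using e2)]
    simp [hfl, e3]
  have hw2 : w₁ ≤ w₂ := by simpa using (h3 0).trans (h4 0)
  set e : ℝ := (((m + 1 : ℕ) : ℝ) - 1) / (m + 1 : ℕ) with he
  have he0 : 0 ≤ e := by rw [he]; push_cast; simp; positivity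
  have he1 : e ≤ 1 := by rw [he]; push_cast; rw [div_le_one (by positivity)]; simp
  have hpow : ∀ l : ℕ, (((l : ℝ) + 1) ^ (m + 1)) ^ e = ((l : ℝ) + 1) ^ m := fun l => by
    rw [← Real.rpow_natCast, ← Real.rpow_mul (by positivity), ← Real.rpow_natCast, he]
    congr 1
    push_cast
    field_simp
    ring
  have hle : ∀ b : ℕ, 1 ≤ b → (b : ℝ) ^ e ≤ b := fun b hb => by
    simpa using Real.rpow_le_rpow_of_exponent_le (by exact_mod_cast hb : (1 : ℝ) ≤ b) he1
  refine ⟨w₁ / E, w₂ * a, by positivity, ?_, ?_⟩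
  · have b1 : (w₁ : ℝ) / E ≤ w₁ := div_le_self (by positivity) (by exact_mod_cast hE)
    have b2 : (w₁ : ℝ) ≤ w₂ := by exact_mod_cast hw2
    have b3 : (w₂ : ℝ) ≤ w₂ * a := le_mul_of_one_le_right (by positivity) (by exact_mod_cast ha)
    linarith
  refine (Set.infinite_range_of_injective hτ.injective).mono ?_
  rintro _ ⟨l, rfl⟩
  simp only [Set.mem_ofPred_eq, hgap]
  have c1 : ((l : ℝ) + 1) ^ (m + 1) ≤ a * τ l := by exact_mod_cast h1 l
  have c2 : (τ l : ℝ) ≤ E * ((l : ℝ) + 1) ^ (m + 1) := by exact_mod_cast h2 l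
  have c3 : w₁ * ((l : ℝ) + 1) ^ m ≤ g l := by exact_mod_cast h3 l
  have c4 : (g l : ℝ) ≤ w₂ * ((l : ℝ) + 1) ^ m := by exact_mod_cast h4 l
  have d1 := Real.rpow_le_rpow (by positivity) c1 he0
  have d2 := Real.rpow_le_rpow (by positivity) c2 he0
  rw [Real.mul_rpow (by positivity) (by positivity), hpow] at d2
  rw [Real.mul_rpow (by positivity) (by positivity), hpow] at d1
  have d3 := mul_le_mul_of_nonneg_right (hle a ha) (by positivity : (0 : ℝ) ≤ (τ l : ℝ) ^ e)
  have d4 := mul_le_mul_of_nonneg_right (hle E hE) (by positivity : (0 : ℝ) ≤ ((l : ℝ) + 1) ^ m)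
  push_cast
  constructor
  · refine le_trans ?_ c3
    rw [div_mul_eq_mul_div, div_le_iff₀ (by positivity)]
    have := mul_le_mul_of_nonneg_left (d2.trans d4) (by positivity : (0 : ℝ) ≤ w₁)
    linarith
  · refine c4.trans ?_
    rw [mul_assoc]
    exact mul_le_mul_of_nonneg_left (d1.trans d3) (by positivity)

lemma exists_uFlat_square (l : ℕ) (s : (Fin 2 → ℕ) × (Fin 2 → ℕ)) (q : Fin 2)
    (hs : UFlat univ q ((l + 1) * (l + 1)) ((l + 1) * (l + 2)) s)
    (hV : ∀ i, i ≠ q → s.2 i + 2 * (l + 1) = (l + 1) * (l + 2)) :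
    ∃ s' q', PlayReach univ s s' ∧ UFlat univ q' ((l + 2) * (l + 2)) ((l + 2) * (l + 3)) s' ∧
      ∀ i, i ≠ q' → s'.2 i + 2 * (l + 2) = (l + 2) * (l + 3) := by
  obtain ⟨s', r, hr, h1, h2, h3⟩ := hs.exists_overshoot (d := 2 * (l + 1)) (by simp)
    (fun i _ => hV i)
  refine ⟨s', r, h1, ?_, fun i hi => ?_⟩
  · convert h2 using 1 <;> ring
  · rw [show i = q by omega, h3]
    ring

lemma exists_dynamic_two :
    ∃ U V : ℕ → Fin 2 → ℕ, IsDynamic 2 U V ∧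
      ∃ c C : ℝ, 0 < c ∧ c ≤ C ∧
        {T : ℕ |
          c * (T : ℝ) ^ ((((2 : ℕ) : ℝ) - 1) / (2 : ℕ)) ≤ (gap 2 U V (2 * T) : ℝ) ∧
          (gap 2 U V (2 * T) : ℝ) ≤ C * (T : ℝ) ^ ((((2 : ℕ) : ℝ) - 1) / (2 : ℕ))}.Infinite := by
  have e0 : PlayReach (univ : Finset (Fin 2)) 0
      (0 + Pi.single 0 1 + Pi.single 1 1, 0 + Pi.single 1 1 + Pi.single 1 1) :=
    (playReach_single_single (s := 0) (p := 0) (q := 1) (mem_univ _) (mem_univ _) (by simp)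
      (by simp) (by simp) 1 (by simp)).trans
    (playReach_single_self (mem_univ _) (by decide) 1 (by decide))
  obtain ⟨x, hx0, hx⟩ := exists_seq
    (P := fun l s => ∃ q, UFlat univ q ((l + 1) * (l + 1)) ((l + 1) * (l + 2)) s ∧
      ∀ i, i ≠ q → s.2 i + 2 * (l + 1) = (l + 1) * (l + 2))
    (R := fun _ s s' => PlayReach (univ : Finset (Fin 2)) s s')
    (a := (0 + Pi.single 0 1 + Pi.single 1 1, 0 + Pi.single 1 1 + Pi.single 1 1))
    ⟨1, by unfold UFlat; decide, by decide⟩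
    (fun l s ⟨q, h1, h2⟩ => by
      obtain ⟨s', q', h3, h4, h5⟩ := exists_uFlat_square l s q h1 h2
      exact ⟨s', ⟨q', h4, h5⟩, h3⟩)
  refine exists_dynamic_of_states (m := 1) x (fun l => (l + 1) ^ 2) (fun l => l + 1) (a := 1)
    (E := 1) (w₁ := 1) (w₂ := 1) le_rfl le_rfl (hx0 ▸ e0) (fun l => (hx l).2)
    (fun a b h => Nat.pow_lt_pow_left (by omega) (by omega)) (fun l => ?_) (fun l => ?_)
    (by simp) (by simp) (by simp) (by simp)
  · obtain ⟨⟨q, h1, -⟩, -⟩ := hx l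
    rw [sum_congr rfl h1.2.1]
    simp
    ring
  · obtain ⟨⟨q, ⟨-, h1, h2, h3⟩, -⟩, -⟩ := hx l
    refine ⟨q, q, fun i => ?_, fun i => ?_, ?_⟩
    · rw [h2]
      by_cases hi : i = q
      · rw [hi, h2]
      · exact (h3 i (mem_univ _) hi).le
    · rw [h1 i (mem_univ _), h1 q (mem_univ _)]
    · rw [h2, h1 q (mem_univ _)]
      ring

/-- `V` is constant on all of the `n` coordinates, `U` has minimum `T`, and the gap is `h + 1`. -/
def GapState (n T h : ℕ) (s : (Fin n → ℕ) × (Fin n → ℕ)) : Prop :=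
  ∃ p r, VFlat univ p r T (T + h + 1) (n * h + 2) s

lemma GapState.exists_raise {k T h γ : ℕ} (hk : 1 ≤ k)
    {s : (Fin (k + 1) → ℕ) × (Fin (k + 1) → ℕ)} (hs : GapState (k + 1) T h s)
    (hR : CanRaise (Fin (k + 1)) k (2 + (k + 1) * h) γ) :
    ∃ s', PlayReach univ s s' ∧ GapState (k + 1) (T + (2 + (k + 1) * h)) (h + γ) s' := by
  obtain ⟨p, r, hs⟩ := hs
  obtain ⟨s₁, q, h1, h2⟩ := hs.exists_uFlat (by simp) (by omega) (add_comm 2 _ ▸ hR)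
  obtain ⟨s₂, r', S, h3, h4⟩ := h2.exists_vFlat (by simp; omega)
  have e1 := PlayReach.sum_add_sum (h1.trans h3)
  have e2 := h4.sum_fst
  have e3 := hs.sum_fst
  rw [h4.sum_snd, hs.sum_snd] at e1
  simp only [card_univ, Fintype.card_fin] at e1 e2 e3
  refine ⟨s₂, h1.trans h3, q, r', ?_⟩
  convert h4 using 1
  · ring
  · ring
  · nlinarith

lemma exists_gapState_one {k : ℕ} (hk : 2 ≤ k) :
    ∃ s, PlayReach univ 0 s ∧ GapState (k + 1) (k + 2) 1 s := by
  obtain ⟨q, x, hqx⟩ : ∃ q x : Fin (k + 1), q ≠ x := ⟨0, Fin.last k, by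
    simp [Fin.ext_iff]; omega⟩
  have e1 : PlayReach univ 0 ((Pi.single q 1, Pi.single q 1) : (Fin (k + 1) → ℕ) × _) :=
    .single ⟨q, mem_univ _, q, mem_univ _, by simp, by simp, by simp⟩
  obtain ⟨s₂, r, e2, hr, g1, g2, g3, -, -, -⟩ := exists_playReach_fill (e := 0) (T := 0) (M := 1)
    (A := univ) (s := (Pi.single q 1, Pi.single q 1)) (mem_univ q) (by simp)
    (fun l _ hl => by simp [hl]) (Nat.zero_le _) (fun l _ hl => by simp [hl]) (univ.erase q)
    subset_rfl
  have hU : ∀ l, l ≠ q → s₂.1 l = 0 := fun l hl => by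
    by_cases hlr : l = r
    · rcases hr with ⟨rfl, -, -⟩ | ⟨-, hr⟩
      · exact absurd hlr hl
      · rw [hlr, hr]
    · exact g1 l (by simp [hl]) hlr
  have hV : ∀ l, s₂.2 l = 1 := fun l => by
    by_cases hl : l = q
    · rw [hl, g3]
    · exact g2 l (by simp [hl])
  have hUq : s₂.1 q = k + 1 := by
    have := PlayReach.sum_add_sum (e1.trans e2)
    rw [← add_sum_erase univ s₂.1 (mem_univ q),
      sum_congr rfl (fun l hl => hU l (ne_of_mem_erase hl))] at this
    simpa [hV] using this
  have e3 := playReach_single_single (s := s₂) (mem_univ q) (mem_univ x) hqx (by simp [hV])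
    (by simp [hU x hqx.symm]) 1 (by simp [hV])
  set s₃ : (Fin (k + 1) → ℕ) × (Fin (k + 1) → ℕ) :=
    (s₂.1 + Pi.single q 1, s₂.2 + Pi.single x 1) with hs₃
  have hV₃ : ∀ l, l ≠ x → s₃.2 l = 1 := fun l hl => by simp [hs₃, hl, hV]
  have hU₃ : s₃.1 q = k + 2 := by simp [hs₃, hUq]
  have hx : x ∈ univ.erase q := by simp [hqx.symm]
  have hcard : #(univ.erase q) = k := by simp
  have f3 : UFlat (univ.erase q) x 0 (1 + 1) s₃ :=
    ⟨hx, fun l hl => by simp [hs₃, hU l (ne_of_mem_erase hl), ne_of_mem_erase hl],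
      by simp [hs₃, hV], fun l _ hl => by rw [hV₃ l hl]; omega⟩
  obtain ⟨s₄, r', e4, f4⟩ := f3.exists_playStart (by rw [hcard]; exact hk) (fun l _ hl => hV₃ l hl)
  obtain ⟨s₅, y, e5, f5⟩ := (CanRaise.one_zero k).mono hk (show 1 ≤ k + 2 by omega) _ r' _ _ s₄
    hcard f4
  have e45 := PlayReach.of_erase (e4.trans e5) ⟨x, hx, by rw [hV₃ q hqx]; simp [hs₃, hV]⟩
    ⟨y, f5.1, by rw [f5.2.1 y f5.1, hU₃]; omega⟩
  have hq5 := PlayReach.eq_of_notMem (e4.trans e5) (notMem_erase q univ)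
  have f6 : UFlat univ y (k + 2) (k + 4) s₅ := by
    refine ⟨mem_univ _, fun l _ => ?_, by rw [f5.2.2.1]; ring, fun l _ hl => ?_⟩
    · by_cases hlq : l = q
      · rw [hlq, hq5.1, hU₃]
      · rw [f5.2.1 l (by simp [hlq])]; ring
    · by_cases hlq : l = q
      · rw [hlq, hq5.2, hV₃ q hqx]; omega
      · have := f5.2.2.2 l (by simp [hlq]) hl; omega
  obtain ⟨s₆, r₆, S, e6, f6⟩ := f6.exists_vFlat (by simp; omega)
  have hreach := (((e1.trans e2).trans e3).trans e45).trans e6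
  have h1 := PlayReach.sum_add_sum hreach
  have h2 := f6.sum_fst
  rw [f6.sum_snd] at h1
  simp at h1 h2
  refine ⟨s₆, hreach, y, r₆, ?_⟩
  convert f6 using 1
  nlinarith

lemma exists_gapState {k : ℕ} (hk : 2 ≤ k) {h : ℕ} (hh : 1 ≤ h) :
    ∃ s T, 1 ≤ T ∧ PlayReach univ 0 s ∧ GapState (k + 1) T h s := by
  induction h, hh using Nat.le_induction with
  | base =>
    obtain ⟨s, h1, h2⟩ := exists_gapState_one hk
    exact ⟨s, k + 2, by omega, h1, h2⟩
  | succ h hh ih =>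
    obtain ⟨s, T, hT, h1, h2⟩ := ih
    obtain ⟨s', h3, h4⟩ := h2.exists_raise (by omega)
      ((CanRaise.three_one hk).mono hk (by nlinarith))
    exact ⟨s', _, by omega, h1.trans h3, h4⟩

lemma exists_dynamic_add_two {m : ℕ} (hm : 1 ≤ m) :
    ∃ U V : ℕ → Fin (m + 1 + 1) → ℕ, IsDynamic (m + 1 + 1) U V ∧
      ∃ c C : ℝ, 0 < c ∧ c ≤ C ∧
        {T : ℕ |
          c * (T : ℝ) ^ ((((m + 1 + 1 : ℕ) : ℝ) - 1) / (m + 1 + 1 : ℕ)) ≤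
            (gap (m + 1 + 1) U V ((m + 1 + 1) * T) : ℝ) ∧
          (gap (m + 1 + 1) U V ((m + 1 + 1) * T) : ℝ) ≤
            C * (T : ℝ) ^ ((((m + 1 + 1 : ℕ) : ℝ) - 1) / (m + 1 + 1 : ℕ))}.Infinite := by
  obtain ⟨D, hD, hR⟩ := CanRaise.exists_bound (ι := Fin (m + 1 + 1)) m hm
  set W := D * (2 ^ (m + 1)) ^ (m + 1) with hW
  have hW1 : 1 ≤ W := Nat.mul_pos hD (by positivity)
  obtain ⟨s₀, T₀, hT₀, h0, hs₀⟩ := exists_gapState (k := m + 1) (by omega) hW1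
  set F := W * (2 + (m + 2) * W) with hF
  obtain ⟨x, hx0, hx⟩ := exists_seq
    (P := fun l (y : ((Fin (m + 1 + 1) → ℕ) × (Fin (m + 1 + 1) → ℕ)) × ℕ) =>
      GapState (m + 1 + 1) y.2 (W * (l + 1) ^ (m + 1)) y.1)
    (R := fun l y y' => PlayReach univ y.1 y'.1 ∧ y.2 + W * (l + 1) ^ (m + 1) ≤ y'.2 ∧
      y'.2 ≤ y.2 + F * (l + 1 + 1) ^ (m + 1))
    (a := (s₀, T₀)) (by simpa using hs₀)
    (fun l ⟨s, T⟩ hs => by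
      obtain ⟨T', ⟨s', h1, h2⟩, h3, h4⟩ := exists_stage (R := CanRaise (Fin (m + 1 + 1)) (m + 1))
        (Q := fun T h => ∃ s', PlayReach univ s s' ∧ GapState (m + 1 + 1) T h s')
        (K := m + 2) (c := 2) hm (by omega) (fun T T' γ h h' => h.mono (by omega) h') hR
        (fun T h γ ⟨s₁, h1, h2⟩ h3 => by
          obtain ⟨s₂, h4, h5⟩ := h2.exists_raise (by omega) h3
          exact ⟨s₂, h1.trans h4, h5⟩) hW hW1 (show 1 ≤ l + 1 by omega) ⟨s, .refl, hs⟩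
        (Nat.mul_le_mul_left W (Nat.pow_le_pow_left (show l + 1 ≤ l + 1 + 1 by omega) _)) le_rfl
      exact ⟨(s', T'), h2, h1, h3, h4⟩)
  have hmonoT : ∀ l, (x l).2 < (x (l + 1)).2 := fun l => by
    have h1 := (hx l).2.2.1
    have : 0 < W * (l + 1) ^ (m + 1) := by positivity
    omega
  have hlow : ∀ l, (l + 1) ^ (m + 2) ≤ 2 ^ (m + 2) * (x l).2 := fun l => by
    induction l with
    | zero => rw [hx0]; simp; nlinarith [Nat.one_le_two_pow (n := m + 2)]
    | succ l ih =>
      have h1 := succ_pow_le_add_two_pow_mul (show 1 ≤ l + 1 by omega) (m + 1)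
      have h2 := (hx l).2.2.1
      have h3 : (l + 1) ^ (m + 1) ≤ W * (l + 1) ^ (m + 1) := Nat.le_mul_of_pos_left _ hW1
      have h4 := Nat.mul_le_mul_left (2 ^ (m + 2)) ((Nat.add_le_add_left h3 _).trans h2)
      rw [mul_add] at h4
      rw [show m + 1 + 1 = m + 2 from rfl] at h1
      omega
  have hup : ∀ l, (x l).2 ≤ (T₀ + F) * (l + 1) ^ (m + 2) := fun l => by
    induction l with
    | zero => rw [hx0]; simp
    | succ l ih =>
      have h1 := (hx l).2.2.2
      have h2 := Nat.mul_le_mul_left (T₀ + F) (pow_succ_add_pow_le (l + 1) m)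
      have : 0 ≤ T₀ * (l + 1 + 1) ^ (m + 1) := Nat.zero_le _
      nlinarith
  refine exists_dynamic_of_states (m := m + 1) (fun l => (x l).1)
    (fun l => (x l).2 + W * (l + 1) ^ (m + 1) + 1) (fun l => W * (l + 1) ^ (m + 1) + 1)
    (a := 2 ^ (m + 2)) (E := T₀ + F + W + 1) (w₁ := W) (w₂ := W + 1) (by omega) hW1
    (by simpa [hx0] using h0) (fun l => (hx l).2.1)
    (strictMono_nat_of_lt_succ fun l => ?_) (fun l => ?_) (fun l => ?_) (fun l => ?_) (fun l => ?_)
    (fun l => by omega) (fun l => ?_)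
  · have h1 := hmonoT l
    have := Nat.mul_le_mul_left W (Nat.pow_le_pow_left (show l + 1 ≤ l + 1 + 1 by omega) (m + 1))
    omega
  · obtain ⟨p, r, h⟩ := (hx l).1
    have h1 := h.sum_fst
    simp only [card_univ, Fintype.card_fin] at h1
    nlinarith
  · obtain ⟨p, r, -, -, -, h1, h2, h3, h4⟩ := (hx l).1
    refine ⟨p, r, fun i => by rw [h4 i (mem_univ _), h4 p (mem_univ _)], fun i => ?_,
      by rw [h4 p (mem_univ _), h2]; ring⟩
    by_cases hp : i = p
    · rw [hp, h1, h2]; omega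
    · by_cases hr : i = r
      · rw [hr]
      · rw [h3 i (mem_univ _) hp hr, h2]; omega
  · exact (hlow l).trans (Nat.mul_le_mul_left _ (by omega))
  · have h1 := hup l
    have h2 : (l + 1) ^ (m + 1) ≤ (l + 1) ^ (m + 2) := Nat.pow_le_pow_right (by omega) (by omega)
    have h3 := Nat.mul_le_mul_left W h2
    have h4 : 1 ≤ (l + 1) ^ (m + 2) := Nat.one_le_pow _ _ (by omega)
    show _ ≤ (T₀ + F + W + 1) * (l + 1) ^ (m + 2)
    nlinarith
  · have h4 : 1 ≤ (l + 1) ^ (m + 1) := Nat.one_le_pow _ _ (by omega)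
    nlinarith

end Play

/-- For every `n ≥ 2` there exist a dynamic `(U, V)` for `Iₙ` and constants
`C ≥ c > 0` such that infinitely many `T` satisfy
`c·T^((n−1)/n) ≤ gap(nT) ≤ C·T^((n−1)/n)`. -/
theorem stmt_0 :
    ∀ n : ℕ, 2 ≤ n →
      ∃ U V : ℕ → Fin n → ℕ, IsDynamic n U V ∧
        ∃ c C : ℝ, 0 < c ∧ c ≤ C ∧
          {T : ℕ |
            c * (T : ℝ) ^ (((n : ℝ) - 1) / n) ≤ (gap n U V (n * T) : ℝ) ∧
            (gap n U V (n * T) : ℝ) ≤ C * (T : ℝ) ^ (((n : ℝ) - 1) / n)}.Infinite := by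
  intro n hn
  obtain rfl | ⟨m, hm, rfl⟩ : n = 2 ∨ ∃ m, 1 ≤ m ∧ n = m + 1 + 1 := by
    rcases (by omega : n = 2 ∨ 3 ≤ n) with h | h
    · exact .inl h
    · exact .inr ⟨n - 2, by omega, by omega⟩
  · exact exists_dynamic_two
  · exact exists_dynamic_add_two hm
end

section
/- For every n ≥ 3 there exists a dynamic (U,V) for the n×n identity matrix I_n such that for every real constant C > 0 there are infinitely many steps t with gap(t) > C·t^(1/2). In other words, fictitious play with arbitrary tie-breaking need not converge at rate O(t^(−1/2)), disproving Karlin's strong conjecture. -/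
/-- A finite path ending at `s` can be prolonged, without changing it, to one ending at any `s'`
reachable from `s` in at least one step. -/
theorem exists_extension_of_transGen {α : Type*} {r : α → α → Prop} {s s' : α}
    (h : Relation.TransGen r s s') (f : ℕ → α) (T : ℕ) (hs : f T = s)
    (hf : ∀ t < T, r (f t) (f (t + 1))) :
    ∃ (f' : ℕ → α) (T' : ℕ), T < T' ∧ (∀ t ≤ T, f' t = f t) ∧
      (∀ t < T', r (f' t) (f' (t + 1))) ∧ f' T' = s' := by
  have snoc : ∀ (f : ℕ → α) (T : ℕ) (c : α), (∀ t < T, r (f t) (f (t + 1))) → r (f T) c →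
      ∀ t < T + 1, r (Function.update f (T + 1) c t) (Function.update f (T + 1) c (t + 1)) := by
    intro f T c hf hc t ht
    rw [Function.update_of_ne (by omega)]
    rcases Nat.lt_succ_iff_lt_or_eq.mp ht with h | rfl
    · rw [Function.update_of_ne (by omega)]
      exact hf t h
    · rwa [Function.update_self]
  induction h with
  | @single b hb =>
    refine ⟨Function.update f (T + 1) b, T + 1, by omega, ?_, snoc f T b hf (hs ▸ hb), by simp⟩
    intro t ht
    rw [Function.update_of_ne (by omega)]
  | @tail b c _ hbc ih =>
    obtain ⟨f', T', hT, hagree, hf', hb⟩ := ih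
    refine ⟨Function.update f' (T' + 1) c, T' + 1, by omega, ?_,
      snoc f' T' c hf' (hb ▸ hbc), by simp⟩
    intro t ht
    rw [Function.update_of_ne (by omega), hagree t ht]

/-- Finite pieces of paths can be glued: if from every state satisfying an invariant `I` one can
reach, for each `k`, a later state satisfying `I` and `Q k`, then there is an infinite path
satisfying each `Q k` at some time `≥ k`. -/
theorem exists_path_of_forall_exists_transGen {α : Type*} {r : α → α → Prop} {I : α → Prop}
    {Q : ℕ → α → Prop}
    (h : ∀ s, I s → ∀ k, ∃ s', Relation.TransGen r s s' ∧ I s' ∧ Q k s') (s₀ : α) (h₀ : I s₀) :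
    ∃ f : ℕ → α, f 0 = s₀ ∧ (∀ t, r (f t) (f (t + 1))) ∧ ∀ k, ∃ t, k ≤ t ∧ Q k (f t) := by
  let P := {p : (ℕ → α) × ℕ // p.1 0 = s₀ ∧ (∀ t < p.2, r (p.1 t) (p.1 (t + 1))) ∧ I (p.1 p.2)}
  have next : ∀ (k : ℕ) (p : P), ∃ q : P, p.1.2 < q.1.2 ∧ (∀ t ≤ p.1.2, q.1.1 t = p.1.1 t) ∧
      Q k (q.1.1 q.1.2) := by
    rintro k ⟨⟨f, T⟩, hf0, hf, hI⟩
    obtain ⟨s', hs', hI', hQ⟩ := h _ hI k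
    obtain ⟨f', T', hT, hagree, hf', hend⟩ := exists_extension_of_transGen hs' f T rfl hf
    refine ⟨⟨⟨f', T'⟩, (hagree 0 (Nat.zero_le _)).trans hf0, hf', ?_⟩, hT, hagree, ?_⟩
    · simpa only [hend] using hI'
    · simpa only [hend] using hQ
  choose nx hlt hagree hQ using next
  let p : ℕ → P := fun k => Nat.rec ⟨⟨fun _ => s₀, 0⟩, rfl, by simp, h₀⟩ nx k
  have hp : ∀ k, p (k + 1) = nx k (p k) := fun k => rfl
  have hge : ∀ k, k ≤ (p k).1.2 := by
    intro k
    induction k with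
    | zero => exact Nat.zero_le _
    | succ k ih =>
      have := hlt k (p k)
      rw [hp]
      omega
  have hmono : Monotone fun k => (p k).1.2 :=
    monotone_nat_of_le_succ fun k => by
      have := hlt k (p k)
      simp only [hp]
      omega
  have hstable : ∀ k m t, t ≤ (p k).1.2 → (p (k + m)).1.1 t = (p k).1.1 t := by
    intro k m t ht
    induction m with
    | zero => rfl
    | succ m ih =>
      rw [← add_assoc, hp, hagree _ _ t (ht.trans (hmono (Nat.le_add_right k m))), ih]
  refine ⟨fun t => (p t).1.1 t, (p 0).2.1, fun t => ?_, fun k => ?_⟩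
  · have h1 := hstable t 1 t (hge t)
    have h2 := (p (t + 1)).2.2.1 t (hge (t + 1))
    simpa only [h1] using h2
  · have h1 : k ≤ (p (k + 1)).1.2 := (Nat.le_succ k).trans (hge (k + 1))
    refine ⟨(p (k + 1)).1.2, h1, ?_⟩
    have hle := hge (k + 1)
    obtain ⟨m, hm⟩ := Nat.exists_eq_add_of_le hle
    have h2 := hstable (k + 1) m (p (k + 1)).1.2 le_rfl
    rw [← hm] at h2
    simp only [h2]
    exact hQ k (p k)

/-- One step of fictitious play on the identity matrix, from the state `(U, V)`. -/
def DynStep {n : ℕ} (s s' : (Fin n → ℕ) × (Fin n → ℕ)) : Prop :=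
  ∃ i j : Fin n,
    (∀ l, s.2 l ≤ s.2 i) ∧ (∀ l, s.1 j ≤ s.1 l) ∧
    (∀ l, s'.1 l = s.1 l + if l = i then 1 else 0) ∧
    (∀ l, s'.2 l = s.2 l + if l = j then 1 else 0)

/-- Reachability by finitely many steps of fictitious play. -/
abbrev DynReach {n : ℕ} : (Fin n → ℕ) × (Fin n → ℕ) → (Fin n → ℕ) × (Fin n → ℕ) → Prop :=
  Relation.ReflTransGen DynStep

section Dynamics

variable {n : ℕ}

theorem DynStep.sum_eq {s s' : (Fin n → ℕ) × (Fin n → ℕ)} (h : DynStep s s') :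
    ∑ l, s'.1 l = ∑ l, s.1 l + 1 ∧ ∑ l, s'.2 l = ∑ l, s.2 l + 1 := by
  obtain ⟨i, j, -, -, hU, hV⟩ := h
  simp [hU, hV, Finset.sum_add_distrib]

theorem DynReach.sum_eq {s s' : (Fin n → ℕ) × (Fin n → ℕ)} (h : DynReach s s')
    (hs : ∑ l, s.1 l = ∑ l, s.2 l) : ∑ l, s'.1 l = ∑ l, s'.2 l := by
  induction h with
  | refl => exact hs
  | tail _ hbc ih =>
    have := hbc.sum_eq
    omega

theorem DynReach.repeat_ne (U V : Fin n → ℕ) {x y : Fin n} (hxy : x ≠ y) (k : ℕ)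
    (hV : ∀ l, V l ≤ V x) (hU : ∀ l, U y ≤ U l) (hk : V y + k ≤ V x + 1) :
    DynReach (U, V) (fun l => U l + if l = x then k else 0,
      fun l => V l + if l = y then k else 0) := by
  induction k with
  | zero => simpa using Relation.ReflTransGen.refl
  | succ k ih =>
    refine (ih (by omega)).tail ⟨x, y, fun l => ?_, fun l => ?_, fun l => ?_, fun l => ?_⟩
    · have := hV l
      by_cases h : l = y
      · subst h
        simp [hxy]
        omega
      · simp [h, hxy, this]
    · have := hU l
      simp [hxy.symm]
      omega
    · by_cases h : l = x <;> simp [h]; omega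
    · by_cases h : l = y <;> simp [h]; omega

theorem DynReach.repeat_self (U V : Fin n → ℕ) (x : Fin n) (k : ℕ)
    (hV : ∀ l, V l ≤ V x) (hU : ∀ l, l ≠ x → U x + k ≤ U l + 1) :
    DynReach (U, V) (fun l => U l + if l = x then k else 0,
      fun l => V l + if l = x then k else 0) := by
  induction k with
  | zero => simpa using Relation.ReflTransGen.refl
  | succ k ih =>
    refine (ih fun l hl => by have := hU l hl; omega).tail
      ⟨x, x, fun l => ?_, fun l => ?_, fun l => ?_, fun l => ?_⟩
    · have := hV l
      by_cases h : l = x <;> simp [h]; omega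
    · by_cases h : l = x
      · simp [h]
      · have := hU l h
        simp [h]
        omega
    · by_cases h : l = x <;> simp [h]; omega
    · by_cases h : l = x <;> simp [h]; omega

/-- From any state in which `x` and `y` are tied both for the minimum `u` of `U` and the maximum `v`
of `V`, while `U l ≥ u + a` for all other `l`, one can play only on `x` and `y` so that `U x`
increases by `a`, `V x` and `V y` increase by `a + g`, and `U y` increases by `a + 2 * g`. -/
def PairReachable (n a g : ℕ) : Prop :=
  ∀ (U V : Fin n → ℕ) (x y : Fin n) (u v : ℕ), x ≠ y → U x = u → U y = u → V x = v → V y = v →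
    (∀ l, V l ≤ v) → (∀ l, l ≠ x → l ≠ y → u + a ≤ U l) →
    ∃ U' V' : Fin n → ℕ, DynReach (U, V) (U', V') ∧
      U' x = u + a ∧ U' y = u + a + 2 * g ∧ V' x = v + a + g ∧ V' y = v + a + g ∧
      ∀ l, l ≠ x → l ≠ y → U' l = U l ∧ V' l = V l

theorem PairReachable.zero : PairReachable n 0 0 := by
  intro U V x y u v _ hUx hUy hVx hVy _ _
  exact ⟨U, V, .refl, by omega, by omega, by omega, by omega, fun l _ _ => ⟨rfl, rfl⟩⟩

theorem PairReachable.advance {a g : ℕ} (h : PairReachable n a g) (ε : ℕ) (hε : ε ≤ 1) :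
    PairReachable n (a + 2 * g) (g + ε) := by
  intro U V x y u v hxy hUx hUy hVx hVy hV hU
  obtain ⟨U₁, V₁, hr, hUy₁, hUx₁, hVy₁, hVx₁, hl₁⟩ := h U V y x u v hxy.symm hUy hUx hVy hVx hV
    (fun l h1 h2 => by have := hU l h2 h1; omega)
  have r₁ := DynReach.repeat_self U₁ V₁ y (2 * g + ε)
    (fun l => by
      have := hV l
      have := hl₁ l
      grind)
    (fun l hl => by
      have := hU l
      have := hl₁ l
      grind)
  have r₂ := DynReach.repeat_ne _ _ hxy.symm (2 * g + ε)
    (fun l => by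
      have := hV l
      have := hl₁ l
      grind)
    (fun l => by
      have := hU l
      have := hl₁ l
      grind)
    (by grind) |> (hr.trans r₁).trans
  refine ⟨_, _, r₂, ?_, ?_, ?_, ?_, ?_⟩ <;> grind

theorem PairReachable.advance_add_one {a g : ℕ} (h : PairReachable n a g) :
    PairReachable n (a + 2 * g + 1) (g + 1) := by
  intro U V x y u v hxy hUx hUy hVx hVy hV hU
  obtain ⟨U₁, V₁, hr, hUy₁, hUx₁, hVy₁, hVx₁, hl₁⟩ := h U V y x u v hxy.symm hUy hUx hVy hVx hV
    (fun l h1 h2 => by have := hU l h2 h1; omega)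
  have r₀ := DynReach.repeat_ne U₁ V₁ hxy 1
    (fun l => by
      have := hV l
      have := hl₁ l
      grind)
    (fun l => by
      have := hU l
      have := hl₁ l
      grind)
    (by omega)
  have r₁ := DynReach.repeat_self _ _ y (2 * g + 1)
    (fun l => by
      have := hV l
      have := hl₁ l
      grind)
    (fun l hl => by
      have := hU l
      have := hl₁ l
      grind) |> (hr.trans r₀).trans
  have r₂ := DynReach.repeat_ne _ _ hxy.symm (2 * g + 2)
    (fun l => by
      have := hV l
      have := hl₁ l
      grind)
    (fun l => by
      have := hU l
      have := hl₁ l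
      grind)
    (by grind) |> r₁.trans
  refine ⟨_, _, r₂, ?_, ?_, ?_, ?_, ?_⟩ <;> grind

theorem PairReachable.one (a : ℕ) : PairReachable n a 1 := by
  induction a using Nat.twoStepInduction with
  | zero => exact PairReachable.zero.advance 1 le_rfl
  | one => exact PairReachable.zero.advance_add_one
  | more a h _ => exact h.advance 0 zero_le_one

theorem PairReachable.of_le (g : ℕ) : ∀ a, g * (g + 1) ≤ a → PairReachable n a (g + 1) := by
  induction g with
  | zero => exact fun a _ => PairReachable.one a
  | succ g ih =>
    intro a ha
    obtain ⟨b, rfl⟩ : ∃ b, a = b + 2 * (g + 1) := ⟨a - 2 * (g + 1), by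
      have : 2 * (g + 1) ≤ (g + 1) * (g + 1 + 1) := by nlinarith
      omega⟩
    exact (ih b (by nlinarith)).advance 1 le_rfl

/-- Two distinct indices attain both the minimum `u` of `U` and the maximum `w` of `V`, where `U`
and `V` have the same total. -/
def PairTied (s : (Fin n → ℕ) × (Fin n → ℕ)) (u w : ℕ) : Prop :=
  ∑ l, s.1 l = ∑ l, s.2 l ∧ ∃ x y : Fin n, x ≠ y ∧ s.1 x = u ∧ s.1 y = u ∧ s.2 x = w ∧ s.2 y = w ∧
    (∀ l, s.2 l ≤ w) ∧ ∀ l, u ≤ s.1 l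

theorem PairTied.sum_le {s : (Fin n → ℕ) × (Fin n → ℕ)} {u w : ℕ} (h : PairTied s u w) :
    ∑ l, s.1 l ≤ n * w := by
  obtain ⟨hsum, x, y, -, -, -, -, -, hV, -⟩ := h
  rw [hsum]
  simpa using Finset.sum_le_card_nsmul Finset.univ s.2 w fun l _ => hV l

theorem PairTied.le_add_mul {s : (Fin n → ℕ) × (Fin n → ℕ)} {u G : ℕ} (h : PairTied s u (u + G))
    (l : Fin n) : s.1 l ≤ u + n * G := by
  have h1 := h.sum_le
  obtain ⟨-, x, y, -, -, -, -, -, -, hU⟩ := h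
  have h2 : ∑ m, (u + if m = l then s.1 l - u else 0) ≤ ∑ m, s.1 m := by
    refine Finset.sum_le_sum fun m _ => ?_
    have := hU m
    split_ifs with hm
    · subst hm; omega
    · omega
  simp only [Finset.sum_add_distrib, Finset.sum_const, Finset.card_univ, Fintype.card_fin,
    smul_eq_mul, Finset.sum_ite_eq', Finset.mem_univ, if_true] at h2
  rw [mul_add] at h1
  omega

theorem PairTied.gap_eq {U V : ℕ → Fin n → ℕ} {t u G : ℕ} (h : PairTied (U t, V t) u (u + G)) :
    gap n U V t = G := by
  obtain ⟨-, x, y, -, hUx, -, hVx, -, hV, hU⟩ := h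
  have : Nonempty (Fin n) := ⟨x⟩
  have h1 : (⨆ l, V t l) = u + G :=
    le_antisymm (ciSup_le hV) (hVx ▸ le_ciSup (f := V t) (Finite.bddAbove_range _) x)
  have h2 : (⨅ l, U t l) = u :=
    le_antisymm (hUx ▸ ciInf_le (f := U t) (OrderBot.bddBelow _) x) (le_ciInf hU)
  rw [gap, h1, h2]
  push_cast
  ring

theorem PairTied.exists_next (hn : 3 ≤ n) {s : (Fin n → ℕ) × (Fin n → ℕ)} {u G : ℕ}
    (h : PairTied s u (u + G)) (M : ℕ) :
    ∃ s' c g, DynReach s s' ∧ PairTied s' (u + c) (u + c + (G + g)) ∧ c ≤ n * G ∧ 1 ≤ g ∧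
      (M ≤ g ∨ c ≤ M * (M + 1)) := by
  have hle := h.le_add_mul
  obtain ⟨hsum, x, y, hxy, hUx, hUy, hVx, hVy, hV, hU⟩ := h
  obtain ⟨U, V⟩ := s
  dsimp only at *
  have hne : ((Finset.univ.erase x).erase y).Nonempty := by
    rw [← Finset.card_pos, Finset.card_erase_of_mem (by simp [hxy.symm]),
      Finset.card_erase_of_mem (by simp), Finset.card_univ, Fintype.card_fin]
    omega
  obtain ⟨z, hz, hmin⟩ := Finset.exists_min_image _ U hne
  simp only [Finset.mem_erase, Finset.mem_univ, and_true, ne_eq] at hz hmin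
  obtain ⟨hzy, hzx⟩ := hz
  obtain ⟨c, hc⟩ := Nat.exists_eq_add_of_le (hU z)
  obtain ⟨g, hg, hgM, hpair⟩ : ∃ g, 1 ≤ g ∧ (M ≤ g ∨ c ≤ M * (M + 1)) ∧ PairReachable n c g := by
    by_cases hcM : c ≤ M * (M + 1)
    · exact ⟨1, le_rfl, .inr hcM, .one c⟩
    · exact ⟨M + 1, by omega, .inl (by omega), .of_le M c (by omega)⟩
  obtain ⟨U₁, V₁, hr, hUx₁, hUy₁, hVx₁, hVy₁, hl₁⟩ := hpair U V x y u (u + G) hxy hUx hUy hVx hVy hV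
    (fun l h1 h2 => hc ▸ hmin l ⟨h2, h1⟩)
  have hz₁ := hl₁ z hzx hzy
  have hVz := hV z
  obtain ⟨k, hk⟩ : ∃ k, V₁ z + k = u + G + c + g := ⟨u + G + c + g - V₁ z, by omega⟩
  have r := DynReach.repeat_ne U₁ V₁ (Ne.symm hzy) k
    (fun l => by
      have := hV l
      have := hl₁ l
      grind)
    (fun l => by
      have := hmin l
      have := hl₁ l
      grind)
    (by omega) |> hr.trans
  refine ⟨_, c, g, r, ⟨DynReach.sum_eq r hsum, x, z, Ne.symm hzx, ?_, ?_, ?_, ?_, fun l => ?_, fun l => ?_⟩,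
    by have := hle z; omega, hg, hgM⟩
  · grind
  · grind
  · grind
  · grind
  · have := hV l
    have := hl₁ l
    grind
  · have := hmin l
    have := hl₁ l
    grind

theorem PairTied.exists_iterate (hn : 3 ≤ n) {s : (Fin n → ℕ) × (Fin n → ℕ)} {u G : ℕ}
    (h : PairTied s u (u + G)) (M k : ℕ) :
    ∃ s' u' G', DynReach s s' ∧ PairTied s' u' (u' + G') ∧ G + k ≤ G' ∧
      M * u' ≤ M * u + M * (M * (M + 1)) * G' + n * G' ^ 2 := by
  induction k with
  | zero => exact ⟨s, u, G, .refl, h, le_rfl, by rw [add_assoc]; exact Nat.le_add_right _ _⟩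
  | succ k ih =>
    obtain ⟨s₁, u₁, G₁, hr₁, ht₁, hG₁, hu₁⟩ := ih
    obtain ⟨s₂, c, g, hr₂, ht₂, hc, hg, hgc⟩ := ht₁.exists_next hn M
    refine ⟨s₂, u₁ + c, G₁ + g, hr₁.trans hr₂, ht₂, by omega, ?_⟩
    rcases hgc with hM | hcM
    · have h1 : M * c ≤ g * (n * G₁) := Nat.mul_le_mul hM hc
      have h2 : 0 ≤ M * (M * (M + 1)) * g := Nat.zero_le _
      have h3 : 0 ≤ n * g * G₁ := Nat.zero_le _
      have h4 : 0 ≤ n * g ^ 2 := Nat.zero_le _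
      linarith
    · have h1 : M * c ≤ M * (M * (M + 1)) * g :=
        (Nat.mul_le_mul_left M hcM).trans (Nat.le_mul_of_pos_right _ hg)
      have h3 : 0 ≤ n * g * G₁ := Nat.zero_le _
      have h4 : 0 ≤ n * g ^ 2 := Nat.zero_le _
      linarith

theorem PairTied.exists_large_gap (hn : 3 ≤ n) {s : (Fin n → ℕ) × (Fin n → ℕ)} {u G : ℕ}
    (h : PairTied s u (u + G)) (C : ℕ) :
    ∃ s' u' G', DynReach s s' ∧ PairTied s' u' (u' + G') ∧ G < G' ∧
      C ^ 2 * ∑ l, s'.1 l < G' ^ 2 := by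
  set M := 2 * C ^ 2 * n ^ 2 + 1 with hM
  set B := u + M * (M + 1) + 1 with hB
  obtain ⟨s', u', G', hr, ht, hG, hu⟩ := h.exists_iterate hn M (2 * C ^ 2 * n * B + 1)
  refine ⟨s', u', G', hr, ht, by omega, ?_⟩
  have hsum := ht.sum_le
  have hG1 : 2 * C ^ 2 * n * B + 1 ≤ G' := by omega
  have h1 : M * (u' + G') ≤ M * (B * G') + n * G' ^ 2 := by
    have : M * u ≤ M * u * G' := Nat.le_mul_of_pos_right _ (by omega)
    rw [hB]
    linarith
  have h2 : 2 * C ^ 2 * n * B * G' < G' ^ 2 := by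
    rw [sq G']
    exact Nat.mul_lt_mul_of_pos_right hG1 (by omega)
  have h3 : M * (2 * (C ^ 2 * (n * (u' + G')))) < M * (2 * G' ^ 2) := by
    calc M * (2 * (C ^ 2 * (n * (u' + G'))))
        = 2 * C ^ 2 * n * (M * (u' + G')) := by ring
      _ ≤ 2 * C ^ 2 * n * (M * (B * G') + n * G' ^ 2) := Nat.mul_le_mul_left _ h1
      _ = M * (2 * C ^ 2 * n * B * G') + 2 * C ^ 2 * n ^ 2 * G' ^ 2 := by ring
      _ < M * G' ^ 2 + M * G' ^ 2 := by
          refine Nat.add_lt_add_of_lt_of_le (Nat.mul_lt_mul_of_pos_left h2 (by omega)) ?_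
          exact Nat.mul_le_mul_right _ (by omega)
      _ = M * (2 * G' ^ 2) := by ring
  have h4 := Nat.lt_of_mul_lt_mul_left h3
  have h5 : C ^ 2 * ∑ l, s'.1 l ≤ C ^ 2 * (n * (u' + G')) := Nat.mul_le_mul_left _ hsum
  omega

theorem exists_path_large_gap (hn : 3 ≤ n) :
    ∃ f : ℕ → (Fin n → ℕ) × (Fin n → ℕ), f 0 = (fun _ => 0, fun _ => 0) ∧
      (∀ t, DynStep (f t) (f (t + 1))) ∧
      ∀ k, ∃ t, k ≤ t ∧ ∃ u G, PairTied (f t) u (u + G) ∧ k ^ 2 * ∑ l, (f t).1 l < G ^ 2 := by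
  refine exists_path_of_forall_exists_transGen (I := fun s => ∃ u G, PairTied s u (u + G))
    (Q := fun k s => ∃ u G, PairTied s u (u + G) ∧ k ^ 2 * ∑ l, s.1 l < G ^ 2) ?_ _ ?_
  · rintro s ⟨u, G, h⟩ k
    obtain ⟨s', u', G', hr, ht, hG, hC⟩ := h.exists_large_gap hn k
    refine ⟨s', ?_, ⟨u', G', ht⟩, u', G', ht, hC⟩
    rcases Relation.reflTransGen_iff_eq_or_transGen.mp hr with rfl | hr
    · obtain ⟨-, x, -, -, hu, -, hw, -, hV, hU⟩ := h
      obtain ⟨-, x', -, -, hu', -, hw', -, hV', hU'⟩ := ht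
      have := hV x'
      have := hV' x
      have := hU x'
      have := hU' x
      omega
    · exact hr
  · exact ⟨0, 0, rfl, ⟨0, by omega⟩, ⟨1, by omega⟩, by simp, rfl, rfl, rfl, rfl,
      fun _ => le_rfl, fun _ => le_rfl⟩

end Dynamics

/-- For every `n ≥ 3` there exists a dynamic `(U, V)` for `Iₙ` such that for every
`C > 0` there are infinitely many steps `t` with `gap(t) > C·t^(1/2)`: fictitious
play with arbitrary tie-breaking need not converge at rate `O(t^(−1/2))`,
disproving Karlin's strong conjecture. -/
theorem stmt_2 :
    ∀ n : ℕ, 3 ≤ n →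
      ∃ U V : ℕ → Fin n → ℕ, IsDynamic n U V ∧
        ∀ C : ℝ, 0 < C →
          {t : ℕ | C * (t : ℝ) ^ ((1 : ℝ) / 2) < (gap n U V t : ℝ)}.Infinite := by
  intro n hn
  obtain ⟨f, hf0, hf, hlarge⟩ := exists_path_large_gap hn
  have hsum : ∀ t, ∑ l, (f t).1 l = t := by
    intro t
    induction t with
    | zero => simp [hf0]
    | succ t ih => rw [(hf t).sum_eq.1, ih]
  refine ⟨fun t => (f t).1, fun t => (f t).2, ⟨by simp [hf0], by simp [hf0], hf⟩, ?_⟩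
  intro C hC
  rw [Set.infinite_iff_exists_gt]
  intro N
  obtain ⟨t, htk, u, G, ht, hG⟩ := hlarge (max (N + 1) ⌈C⌉₊)
  refine ⟨t, ?_, lt_of_lt_of_le (Nat.lt_succ_self N) ((le_max_left _ _).trans htk)⟩
  rw [hsum] at hG
  have hgap := PairTied.gap_eq (U := fun t => (f t).1) (V := fun t => (f t).2) ht
  rw [Set.mem_ofPred_eq, hgap, ← Real.sqrt_eq_rpow, Int.cast_natCast]
  set k := max (N + 1) ⌈C⌉₊
  have hCk : C ≤ k := (Nat.le_ceil C).trans (by exact_mod_cast le_max_right _ _)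
  refine lt_of_le_of_lt (mul_le_mul_of_nonneg_right hCk (Real.sqrt_nonneg _)) ?_
  refine lt_of_pow_lt_pow_left₀ 2 (Nat.cast_nonneg G) ?_
  rw [mul_pow, Real.sq_sqrt (Nat.cast_nonneg t)]
  exact_mod_cast hG
end
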